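/- Let M = M* + E where M* and M are finite-rank operators between Hilbert spaces W′ and W, with singular value decompositions M* = Σ_{i=1}^{r1} σ*_i u*_i ⊗ v*_i and M = Σ_{i=1}^{r2} σ_i u_i ⊗ v_i (singular values in decreasing order). Fix r ≤ min(r1, r2), let U* = span{u*_1,…,u*_r}, U = span{u_1,…,u_r}, with orthogonal projections P_{U*}, P_U. If ‖E‖_op < σ*_r − σ*_{r+1}, then ‖P_{U*} − P_U‖_op ≤ √2 ‖E‖_op / (σ*_r − σ*_{r+1} − ‖E‖_op), where σ*_{r+1} := 0 if r = r1. -/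

import Mathlib

open scoped InnerProductSpace

noncomputable section WedinAux

/-- Diagonal operator `∑ c i • u i ⊗ v i`. -/
def wedinDiag {V W : Type*} [NormedAddCommGroup V] [InnerProductSpace ℝ V]
    [NormedAddCommGroup W] [InnerProductSpace ℝ W] {n : ℕ}
    (u : Fin n → W) (v : Fin n → V) (c : Fin n → ℝ) : V →L[ℝ] W :=
  ∑ i, c i • (innerSL ℝ (v i)).smulRight (u i)

variable {V W X : Type*} [NormedAddCommGroup V] [InnerProductSpace ℝ V]
    [NormedAddCommGroup W] [InnerProductSpace ℝ W]
    [NormedAddCommGroup X] [InnerProductSpace ℝ X]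

lemma wedinDiag_apply {n : ℕ} (u : Fin n → W) (v : Fin n → V) (c : Fin n → ℝ) (x : V) :
    wedinDiag u v c x = ∑ i, (c i * ⟪v i, x⟫_ℝ) • u i := by
  simp [wedinDiag, ContinuousLinearMap.sum_apply, mul_smul]

lemma wedin_norm_sum {n : ℕ} {u : Fin n → W} (hu : Orthonormal ℝ u) (c : Fin n → ℝ) :
    ‖∑ i, c i • u i‖ ^ 2 = ∑ i, c i ^ 2 := by
  rw [← real_inner_self_eq_norm_sq, hu.inner_sum]
  simp [sq]

lemma wedin_bessel {n : ℕ} {v : Fin n → V} (hv : Orthonormal ℝ v) (x : V) :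
    ∑ i, ⟪v i, x⟫_ℝ ^ 2 ≤ ‖x‖ ^ 2 := by
  have := hv.sum_inner_products_le (x := x) (s := Finset.univ)
  simpa using this

lemma wedinDiag_le {n : ℕ} {u : Fin n → W} {v : Fin n → V} (hu : Orthonormal ℝ u)
    (hv : Orthonormal ℝ v) (c : Fin n → ℝ) (x : V) {m : ℝ} (hm : 0 ≤ m)
    (h : ∀ i, |c i| ≤ m ∨ ⟪v i, x⟫_ℝ = 0) : ‖wedinDiag u v c x‖ ≤ m * ‖x‖ := by
  apply le_of_sq_le_sq _ (by positivity)
  rw [wedinDiag_apply, wedin_norm_sum hu, mul_pow]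
  refine le_trans ?_ (mul_le_mul_of_nonneg_left (wedin_bessel hv x) (sq_nonneg m))
  rw [Finset.mul_sum]
  refine Finset.sum_le_sum fun i _ => ?_
  rw [mul_pow]
  rcases h i with h | h
  · have : c i ^ 2 ≤ m ^ 2 := sq_le_sq' (abs_le.1 h).1 (abs_le.1 h).2
    gcongr
  · simp [h]

lemma wedinDiag_norm {n : ℕ} {u : Fin n → W} {v : Fin n → V} (hu : Orthonormal ℝ u)
    (hv : Orthonormal ℝ v) (c : Fin n → ℝ) {m : ℝ} (hm : 0 ≤ m)
    (h : ∀ i, |c i| ≤ m) : ‖wedinDiag u v c‖ ≤ m :=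
  ContinuousLinearMap.opNorm_le_bound _ hm fun x =>
    wedinDiag_le hu hv c x hm fun i => Or.inl (h i)

lemma wedinDiag_comp {n : ℕ} (u : Fin n → W) {v : Fin n → V} (w : Fin n → X)
    (hv : Orthonormal ℝ v) (c d : Fin n → ℝ) :
    wedinDiag u v c ∘L wedinDiag v w d = wedinDiag u w (fun i => c i * d i) := by
  ext x
  simp only [ContinuousLinearMap.comp_apply, wedinDiag_apply]
  refine Finset.sum_congr rfl fun i _ => ?_
  rw [hv.inner_right_fintype, mul_assoc]

lemma wedinDiag_sub {n : ℕ} (u : Fin n → W) (v : Fin n → V) (c d : Fin n → ℝ) :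
    wedinDiag u v c - wedinDiag u v d = wedinDiag u v (fun i => c i - d i) := by
  simp [wedinDiag, sub_smul]

lemma wedinDiag_adjoint [CompleteSpace V] [CompleteSpace W] {n : ℕ}
    (u : Fin n → W) (v : Fin n → V) (c : Fin n → ℝ) :
    (wedinDiag u v c).adjoint = wedinDiag v u c := by
  symm
  rw [ContinuousLinearMap.eq_adjoint_iff]
  intro x y
  simp only [wedinDiag_apply, sum_inner, inner_sum, inner_smul_left, inner_smul_right]
  refine Finset.sum_congr rfl fun i _ => ?_
  simp [real_inner_comm]
  ring

/-- Weyl's inequality. -/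
lemma wedin_weyl {n m : ℕ} {u : Fin n → W} {v : Fin n → V} (hu : Orthonormal ℝ u)
    (hv : Orthonormal ℝ v) {s : Fin n → ℝ} (hs : Antitone s) (hs0 : ∀ i, 0 < s i)
    {u' : Fin m → W} {v' : Fin m → V} (hu' : Orthonormal ℝ u')
    (hv' : Orthonormal ℝ v') {s' : Fin m → ℝ} (hs0' : ∀ i, 0 < s' i)
    (k : Fin n) {β : ℝ} (hβ : 0 ≤ β) (h : ∀ i : Fin m, (k : ℕ) ≤ i → s' i ≤ β) :
    s k ≤ β + ‖wedinDiag u v s - wedinDiag u' v' s'‖ := by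
  have hk : (k : ℕ) + 1 ≤ n := k.2
  let w : Fin (k + 1) → V := v ∘ Fin.castLE hk
  let z : Fin (k + 1) → W := u ∘ Fin.castLE hk
  have hw : Orthonormal ℝ w := hv.comp _ (Fin.castLE_injective hk)
  have hz : Orthonormal ℝ z := hu.comp _ (Fin.castLE_injective hk)
  let L : (Fin (k + 1) → ℝ) →ₗ[ℝ] (Fin k → ℝ) :=
    LinearMap.pi fun j => if hj : (j : ℕ) < m then
      (innerSL ℝ (v' ⟨j, hj⟩)).toLinearMap ∘ₗ (Fintype.linearCombination ℝ w) else 0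
  have hker : LinearMap.ker L ≠ ⊥ := LinearMap.ker_ne_bot_of_finrank_lt (by simp)
  obtain ⟨c, hc, hc0⟩ := Submodule.exists_mem_ne_zero_of_ne_bot hker
  let x : V := ∑ i, c i • w i
  have hx : ‖x‖ ^ 2 = ∑ i, c i ^ 2 := wedin_norm_sum hw c
  have hxpos : 0 < ‖x‖ := by
    obtain ⟨i, hi⟩ := Function.ne_iff.1 hc0
    have h1 : 0 < c i ^ 2 := by
      have : c i ≠ 0 := hi
      positivity
    have h2 : c i ^ 2 ≤ ∑ i, c i ^ 2 :=
      Finset.single_le_sum (f := fun i => c i ^ 2) (fun _ _ => sq_nonneg _) (Finset.mem_univ i)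
    by_contra hcon
    have : ‖x‖ = 0 := le_antisymm (not_lt.1 hcon) (norm_nonneg _)
    rw [this] at hx
    norm_num at hx
    linarith
  have horth : ∀ i : Fin m, (i : ℕ) < k → ⟪v' i, x⟫_ℝ = 0 := by
    intro i hi
    have := congrFun (LinearMap.mem_ker.1 hc) ⟨i, hi⟩
    simpa [L, Fintype.linearCombination_apply, x] using this
  have hB : ‖wedinDiag u' v' s' x‖ ≤ β * ‖x‖ := by
    refine wedinDiag_le hu' hv' s' x hβ fun i => ?_
    rcases lt_or_ge (i : ℕ) k with hi | hi
    · exact Or.inr (horth i hi)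
    · left
      rw [abs_of_pos (hs0' i)]
      exact h i hi
  have hA : s k * ‖x‖ ≤ ‖wedinDiag u v s x‖ := by
    have hAx : wedinDiag u v s x = ∑ i, (s (Fin.castLE hk i) * c i) • z i := by
      have : ∀ i, wedinDiag u v s (w i) = s (Fin.castLE hk i) • z i := by
        intro i
        rw [wedinDiag_apply]
        simp only [w, z, Function.comp, orthonormal_iff_ite.1 hv]
        simp
      simp only [x, map_sum, map_smul, this, smul_smul]
      simp only [mul_comm]
    apply le_of_sq_le_sq _ (norm_nonneg _)
    rw [hAx, wedin_norm_sum hz, mul_pow, hx, Finset.mul_sum]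
    refine Finset.sum_le_sum fun i _ => ?_
    rw [mul_pow]
    have h1 : s k ≤ s (Fin.castLE hk i) := hs (by
      rw [Fin.le_def]; simp; omega)
    have := (hs0 k).le
    gcongr
  have hE : ‖wedinDiag u v s x‖ ≤
      ‖wedinDiag u' v' s' x‖ + ‖wedinDiag u v s - wedinDiag u' v' s'‖ * ‖x‖ := by
    have h1 := (wedinDiag u v s - wedinDiag u' v' s').le_opNorm x
    have h2 : wedinDiag u v s x = wedinDiag u' v' s' x +
      (wedinDiag u v s - wedinDiag u' v' s') x := by simp
    calc _ = _ := congrArg norm h2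
      _ ≤ _ := norm_add_le _ _
      _ ≤ _ := by linarith
  have : s k * ‖x‖ ≤ (β + ‖wedinDiag u v s - wedinDiag u' v' s'‖) * ‖x‖ := by linarith
  exact le_of_mul_le_mul_right this hxpos

/-- Indicator of the first `r` indices. -/
def wedinInd {n : ℕ} (r : ℕ) : Fin n → ℝ := fun i => if (i : ℕ) < r then 1 else 0

lemma wedinInd_norm {n : ℕ} (r : ℕ) {u : Fin n → W} (hu : Orthonormal ℝ u) :
    ‖wedinDiag u u (wedinInd r)‖ ≤ 1 := by
  apply wedinDiag_norm hu hu _ zero_le_one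
  intro i
  unfold wedinInd
  split_ifs <;> simp

lemma wedinInd_norm' {n : ℕ} (r : ℕ) {u : Fin n → W} (hu : Orthonormal ℝ u) :
    ‖ContinuousLinearMap.id ℝ W - wedinDiag u u (wedinInd r)‖ ≤ 1 := by
  refine ContinuousLinearMap.opNorm_le_bound _ zero_le_one fun x => ?_
  set p := wedinDiag u u (wedinInd r) x with hp
  have h : ⟪p, x⟫_ℝ = ‖p‖ ^ 2 := by
    rw [hp, wedinDiag_apply, wedin_norm_sum hu, sum_inner]
    refine Finset.sum_congr rfl fun i _ => ?_
    rw [real_inner_smul_left]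
    unfold wedinInd
    split_ifs <;> simp [sq]
  have h2 := norm_sub_sq_real x p
  rw [real_inner_comm, h] at h2
  rw [one_mul]
  apply le_of_sq_le_sq _ (norm_nonneg _)
  simp only [ContinuousLinearMap.sub_apply, ContinuousLinearMap.id_apply]
  rw [← hp]
  nlinarith [sq_nonneg ‖p‖]

/-- Half of the Wedin argument. -/
lemma wedin_half {n m r : ℕ} {u : Fin n → W} {v : Fin n → V} (hu : Orthonormal ℝ u)
    (hv : Orthonormal ℝ v) {s : Fin n → ℝ}
    {u' : Fin m → W} {v' : Fin m → V} (hu' : Orthonormal ℝ u')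
    (hv' : Orthonormal ℝ v') {s' : Fin m → ℝ} (hs0' : ∀ i, 0 < s' i)
    {α β : ℝ} (hα : 0 < α) (hβ : 0 ≤ β)
    (h : ∀ i : Fin n, (i : ℕ) < r → α ≤ s i)
    (h' : ∀ i : Fin m, r ≤ (i : ℕ) → s' i ≤ β) :
    α * ‖(ContinuousLinearMap.id ℝ W - wedinDiag u' u' (wedinInd r)) ∘L
        wedinDiag u u (wedinInd r)‖ ≤
      β * ‖(ContinuousLinearMap.id ℝ V - wedinDiag v' v' (wedinInd r)) ∘L
        wedinDiag v v (wedinInd r)‖ + ‖wedinDiag u v s - wedinDiag u' v' s'‖ := by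
  set T := ContinuousLinearMap.id ℝ W - wedinDiag u' u' (wedinInd r) with hT
  set S := ContinuousLinearMap.id ℝ V - wedinDiag v' v' (wedinInd r) with hS
  set P := wedinDiag u u (wedinInd r) with hP
  set Q := wedinDiag v v (wedinInd r) with hQ
  set A := wedinDiag u v s with hA
  set B := wedinDiag u' v' s' with hB
  let C : W →L[ℝ] V := wedinDiag v u (fun i => wedinInd r i * (s i)⁻¹)
  have hAC : A ∘L C = P := by
    rw [hA, wedinDiag_comp _ _ hv]
    congr 1
    funext i
    unfold wedinInd
    split_ifs with hi
    · have := h i hi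
      have : s i ≠ 0 := by linarith
      field_simp
    · simp
  have hQC : Q ∘L C = C := by
    rw [hQ, wedinDiag_comp _ _ hv]
    congr 1
    funext i
    unfold wedinInd
    split_ifs <;> simp
  have hC : ‖C‖ ≤ α⁻¹ := by
    apply wedinDiag_norm hv hu _ (by positivity)
    intro i
    unfold wedinInd
    split_ifs with hi
    · have := h i hi
      have h0 : 0 < s i := by linarith
      rw [one_mul, abs_of_pos (by positivity)]
      gcongr
    · simp
      positivity
  have hTB : T ∘L B = wedinDiag u' v' (fun i => s' i - wedinInd r i * s' i) := by
    rw [hT, ContinuousLinearMap.sub_comp, ContinuousLinearMap.id_comp, hB,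
      wedinDiag_comp _ _ hu', wedinDiag_sub]
  have hTBS : T ∘L B = (T ∘L B) ∘L S := by
    rw [hTB, hS, ContinuousLinearMap.comp_sub, ContinuousLinearMap.comp_id,
      wedinDiag_comp _ _ hv', wedinDiag_sub]
    congr 1
    funext i
    unfold wedinInd
    split_ifs <;> simp
  have hTBn : ‖T ∘L B‖ ≤ β := by
    rw [hTB]
    apply wedinDiag_norm hu' hv' _ hβ
    intro i
    unfold wedinInd
    split_ifs with hi
    · simpa using hβ
    · simp only [zero_mul, sub_zero]
      rw [abs_of_pos (hs0' i)]
      exact h' i (not_lt.1 hi)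
  have hTn : ‖T‖ ≤ 1 := wedinInd_norm' r hu'
  have hQn : ‖Q‖ ≤ 1 := wedinInd_norm r hv
  have hkey : T ∘L P = ((T ∘L B) ∘L (S ∘L Q) + T ∘L (A - B) ∘L Q) ∘L C := by
    rw [← ContinuousLinearMap.comp_assoc, ← hTBS, ← hAC]
    conv_lhs => rw [← hQC]
    ext x
    simp
  have hn : ‖T ∘L P‖ ≤ (β * ‖S ∘L Q‖ + ‖A - B‖) * α⁻¹ := by
    rw [hkey]
    refine (ContinuousLinearMap.opNorm_comp_le _ _).trans ?_
    gcongr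
    refine (norm_add_le _ _).trans ?_
    gcongr
    · refine (ContinuousLinearMap.opNorm_comp_le _ _).trans ?_
      gcongr
    · calc _ ≤ ‖T‖ * ‖(A - B) ∘L Q‖ := ContinuousLinearMap.opNorm_comp_le _ _
        _ ≤ 1 * (‖A - B‖ * ‖Q‖) := by
          gcongr
          exact ContinuousLinearMap.opNorm_comp_le _ _
        _ ≤ 1 * (‖A - B‖ * 1) := by gcongr
        _ = _ := by ring
  rw [← div_eq_mul_inv, le_div_iff₀ hα] at hn
  linarith

lemma wedin_full [CompleteSpace V] [CompleteSpace W]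
    {n m r : ℕ} {u : Fin n → W} {v : Fin n → V} (hu : Orthonormal ℝ u)
    (hv : Orthonormal ℝ v) {s : Fin n → ℝ}
    {u' : Fin m → W} {v' : Fin m → V} (hu' : Orthonormal ℝ u')
    (hv' : Orthonormal ℝ v') {s' : Fin m → ℝ} (hs0' : ∀ i, 0 < s' i)
    {α β : ℝ} (hα : 0 < α) (hβ : 0 ≤ β)
    (h : ∀ i : Fin n, (i : ℕ) < r → α ≤ s i)
    (h' : ∀ i : Fin m, r ≤ (i : ℕ) → s' i ≤ β) (hαβ : β < α) :
    ‖(ContinuousLinearMap.id ℝ W - wedinDiag u' u' (wedinInd r)) ∘L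
        wedinDiag u u (wedinInd r)‖ ≤ ‖wedinDiag u v s - wedinDiag u' v' s'‖ / (α - β) := by
  have h1 := wedin_half (r := r) hu hv hu' hv' hs0' hα hβ h h'
  have h2 := wedin_half (r := r) hv hu hv' hu' hs0' hα hβ h h'
  have h3 : ‖wedinDiag v u s - wedinDiag v' u' s'‖ = ‖wedinDiag u v s - wedinDiag u' v' s'‖ := by
    rw [← wedinDiag_adjoint u v, ← wedinDiag_adjoint u' v', ← map_sub]
    exact LinearIsometryEquiv.norm_map _ _
  rw [h3] at h2
  rw [le_div_iff₀ (by linarith)]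
  set x := ‖(ContinuousLinearMap.id ℝ W - wedinDiag u' u' (wedinInd r)) ∘L
        wedinDiag u u (wedinInd r)‖
  set y := ‖(ContinuousLinearMap.id ℝ V - wedinDiag v' v' (wedinInd r)) ∘L
        wedinDiag v v (wedinInd r)‖
  rcases le_total y x with hxy | hxy
  · nlinarith
  · nlinarith

lemma wedin_proj_diff [CompleteSpace W] {n m r : ℕ} {u : Fin n → W} (hu : Orthonormal ℝ u)
    {u' : Fin m → W} (hu' : Orthonormal ℝ u') {t : ℝ}
    (h1 : ‖(ContinuousLinearMap.id ℝ W - wedinDiag u' u' (wedinInd r)) ∘L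
        wedinDiag u u (wedinInd r)‖ ≤ t)
    (h2 : ‖(ContinuousLinearMap.id ℝ W - wedinDiag u u (wedinInd r)) ∘L
        wedinDiag u' u' (wedinInd r)‖ ≤ t) :
    ‖wedinDiag u u (wedinInd r) - wedinDiag u' u' (wedinInd r)‖ ≤ √2 * t := by
  have ht : 0 ≤ t := (norm_nonneg _).trans h1
  set P := wedinDiag u u (wedinInd r) with hP
  set P' := wedinDiag u' u' (wedinInd r) with hP'
  have hPa : P.adjoint = P := wedinDiag_adjoint _ _ _
  have hPa' : P'.adjoint = P' := wedinDiag_adjoint _ _ _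
  have hPP' : P' ∘L P' = P' := by
    rw [hP', wedinDiag_comp _ _ hu']
    congr 1
    funext i
    unfold wedinInd
    split_ifs <;> simp
  have h3 : ‖P' ∘L (ContinuousLinearMap.id ℝ W - P)‖ ≤ t := by
    have : P' ∘L (ContinuousLinearMap.id ℝ W - P) =
        ((ContinuousLinearMap.id ℝ W - P) ∘L P').adjoint := by
      rw [ContinuousLinearMap.adjoint_comp, map_sub, hPa, hPa', ContinuousLinearMap.adjoint_id]
    rw [this]
    exact (LinearIsometryEquiv.norm_map _ _).trans_le h2
  refine ContinuousLinearMap.opNorm_le_bound _ (by positivity) fun x => ?_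
  set a := ((ContinuousLinearMap.id ℝ W - P') ∘L P) x with ha
  set b := (P' ∘L (ContinuousLinearMap.id ℝ W - P)) x with hb
  have hab : (P - P') x = a - b := by simp [ha, hb]
  have hinner : ⟪a, b⟫_ℝ = 0 := by
    have e : P' a = 0 := by
      have : P' (P' (P x)) = P' (P x) := congrArg (fun f : W →L[ℝ] W => f (P x)) hPP'
      simp [ha, this]
    have : ⟪P' a, x - P x⟫_ℝ = ⟪a, b⟫_ℝ := by
      conv_lhs => rw [← hPa']
      rw [ContinuousLinearMap.adjoint_inner_left]
      simp [hb]
    rw [← this, e, inner_zero_left]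
  have hna : ‖a‖ ≤ t * ‖x‖ := ContinuousLinearMap.le_of_opNorm_le _ h1 x
  have hnb : ‖b‖ ≤ t * ‖x‖ := ContinuousLinearMap.le_of_opNorm_le _ h3 x
  apply le_of_sq_le_sq _ (by positivity)
  rw [hab, norm_sub_sq_real, hinner, mul_pow, mul_pow, Real.sq_sqrt (by norm_num)]
  have e1 : ‖a‖ ^ 2 ≤ (t * ‖x‖) ^ 2 := by gcongr
  have e2 : ‖b‖ ^ 2 ≤ (t * ‖x‖) ^ 2 := by gcongr
  nlinarith

lemma wedinInd_sum {n : ℕ} (r : ℕ) (u : Fin n → W) :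
    ∑ i ∈ Finset.univ.filter (fun i : Fin n => (i : ℕ) < r),
      (innerSL ℝ (u i)).smulRight (u i) = wedinDiag u u (wedinInd r) := by
  simp [wedinDiag, wedinInd, Finset.sum_filter, ite_smul]

end WedinAux


/-- **Wedin's sin-Θ theorem for finite-rank operators on Hilbert spaces.**
Let `M = M* + E` with `M*`, `M` finite-rank operators from `W'` to `W`, with
SVDs `M* = Σ_{i<r1} σ*_i u*_i ⊗ v*_i`, `M = Σ_{i<r2} σ_i u_i ⊗ v_i`
(decreasing positive singular values, orthonormal singular vector families).
Fix `r ≤ min(r1, r2)` and let `P_{U*}`, `P_U` be the orthogonal projections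
onto `span{u*_1,…,u*_r}` and `span{u_1,…,u_r}` (written as sums of rank-one
operators).  If `‖E‖ < σ*_r − σ*__{r+1}` (with `σ*_{r+1} := 0` when `r = r1`),
then `‖P_{U*} − P_U‖ ≤ √2 ‖E‖ / (σ*_r − σ*_{r+1} − ‖E‖)`. -/
theorem wedin_finite_rank
    {W W' : Type*}
    [NormedAddCommGroup W] [InnerProductSpace ℝ W] [CompleteSpace W]
    [NormedAddCommGroup W'] [InnerProductSpace ℝ W'] [CompleteSpace W']
    (r1 r2 r : ℕ) (hr0 : 0 < r) (hr1 : r ≤ r1) (hr2 : r ≤ r2)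
    (σs : Fin r1 → ℝ) (us : Fin r1 → W) (vs : Fin r1 → W')
    (σh : Fin r2 → ℝ) (uh : Fin r2 → W) (vh : Fin r2 → W')
    (husON : Orthonormal ℝ us) (hvsON : Orthonormal ℝ vs)
    (huhON : Orthonormal ℝ uh) (hvhON : Orthonormal ℝ vh)
    (hσspos : ∀ i, 0 < σs i) (hσsdec : Antitone σs)
    (hσhpos : ∀ i, 0 < σh i) (hσhdec : Antitone σh)
    (Mstar Mhat : W' →L[ℝ] W)
    (hMstar : Mstar = ∑ i, σs i • (innerSL ℝ (vs i)).smulRight (us i))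
    (hMhat : Mhat = ∑ i, σh i • (innerSL ℝ (vh i)).smulRight (uh i))
    (hgap : ‖Mhat - Mstar‖ <
      σs ⟨r - 1, by omega⟩ - (if h : r < r1 then σs ⟨r, h⟩ else 0)) :
    ‖(∑ i ∈ Finset.univ.filter (fun i : Fin r1 => (i : ℕ) < r),
          (innerSL ℝ (us i)).smulRight (us i)) -
        ∑ i ∈ Finset.univ.filter (fun i : Fin r2 => (i : ℕ) < r),
          (innerSL ℝ (uh i)).smulRight (uh i)‖ ≤
      Real.sqrt 2 * ‖Mhat - Mstar‖ /
        (σs ⟨r - 1, by omega⟩ - (if h : r < r1 then σs ⟨r, h⟩ else 0) -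
          ‖Mhat - Mstar‖) := by
  set b : ℝ := if h : r < r1 then σs ⟨r, h⟩ else 0 with hb
  have hb0 : 0 ≤ b := by
    rw [hb]
    split_ifs with h
    · exact (hσspos _).le
    · exact le_rfl
  have hbs : ∀ i : Fin r1, r ≤ (i : ℕ) → σs i ≤ b := by
    intro i hi
    have h : r < r1 := lt_of_le_of_lt hi i.2
    rw [hb, dif_pos h]
    exact hσsdec (by rw [Fin.le_def]; exact hi)
  set a : ℝ := σs ⟨r - 1, by omega⟩ with ha
  have has : ∀ i : Fin r1, (i : ℕ) < r → a ≤ σs i := by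
    intro i hi
    exact hσsdec (by rw [Fin.le_def]; simp only; omega)
  change Mstar = wedinDiag us vs σs at hMstar
  change Mhat = wedinDiag uh vh σh at hMhat
  have hsymm : ‖wedinDiag us vs σs - wedinDiag uh vh σh‖ = ‖Mhat - Mstar‖ := by
    rw [hMstar, hMhat, norm_sub_rev]
  have hsymm' : ‖wedinDiag uh vh σh - wedinDiag us vs σs‖ = ‖Mhat - Mstar‖ := by
    rw [hMstar, hMhat]
  set ε := ‖Mhat - Mstar‖ with hε
  have hε0 : 0 ≤ ε := norm_nonneg _
  have hhlow : ∀ i : Fin r2, (i : ℕ) < r → a - ε ≤ σh i := by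
    intro i hi
    have := wedin_weyl husON hvsON hσsdec hσspos huhON hvhON hσhpos ⟨r - 1, by omega⟩
      (β := σh i) (hσhpos i).le (fun j hj => hσhdec (by
        rw [Fin.le_def]; simp only at hj; omega))
    rw [hsymm] at this
    linarith
  have hhup : ∀ i : Fin r2, r ≤ (i : ℕ) → σh i ≤ b + ε := by
    intro i hi
    have := wedin_weyl huhON hvhON hσhdec hσhpos husON hvsON hσspos i hb0
      (fun j hj => hbs j (hi.trans hj))
    rw [hsymm'] at this
    exact this
  have h1 := wedin_full (r := r) huhON hvhON husON hvsON hσspos (α := a - ε) (β := b)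
    (by linarith) hb0 hhlow hbs (by linarith)
  have h2 := wedin_full (r := r) husON hvsON huhON hvhON hσhpos (α := a) (β := b + ε)
    (by linarith) (by linarith) has hhup (by linarith)
  rw [hsymm', show a - ε - b = a - b - ε by ring] at h1
  rw [hsymm, show a - (b + ε) = a - b - ε by ring] at h2
  rw [wedinInd_sum, wedinInd_sum, mul_div_assoc]
  exact wedin_proj_diff husON huhON h2 h1
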